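/- arXiv:1604.04876 — 2 statements merged into one kernel-verified Lean document; each statement's English description precedes it below -/
import Mathlib

section
/- Let s be a nonnegative integrable random variable (the seller's value), let b > 0 be a fixed buyer value, and let p ≤ b be a price. Let s* = min(s, b) be the seller's value truncated at b. Then the welfare-to-optimum ratio can only decrease under truncation: E[s + (b − s)·𝟙{s ≤ p}] / E[max(s, b)] ≥ E[s* + (b − s*)·𝟙{s* ≤ p}] / E[max(s*, b)]. -/
open MeasureTheory ProbabilityTheory

/-- **Truncating the seller's distribution can only decrease the ratio.**
For a nonnegative integrable seller value `s`, a fixed buyer value `b > 0`,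
and a price `p ≤ b`, the welfare-to-optimum ratio of the fixed-price
mechanism with price `p` can only decrease when `s` is replaced by its
truncation `min s b`. -/
theorem truncation_decreases_ratio
    {Ω : Type*} [MeasurableSpace Ω] {P : Measure Ω} [IsProbabilityMeasure P]
    (s : Ω → ℝ) (hsm : Measurable s)
    (hs0 : ∀ ω, 0 ≤ s ω) (hsi : Integrable s P)
    (b p : ℝ) (hb : 0 < b) (hpb : p ≤ b) :
    (∫ ω, (s ω + (b - s ω) * (if s ω ≤ p then (1:ℝ) else 0)) ∂P)
        / (∫ ω, max (s ω) b ∂P)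
      ≥ (∫ ω, (min (s ω) b + (b - min (s ω) b) * (if min (s ω) b ≤ p then (1:ℝ) else 0)) ∂P)
        / (∫ ω, max (min (s ω) b) b ∂P) := by
  have hsb : Measurable fun ω => min (s ω) b := hsm.min measurable_const
  set W : Ω → ℝ := fun ω =>
    min (s ω) b + (b - min (s ω) b) * (if min (s ω) b ≤ p then (1:ℝ) else 0) with hW
  set D : Ω → ℝ := fun ω => max (s ω - b) 0 with hD
  have hWm : Measurable W :=
    hsb.add ((measurable_const.sub hsb).mul
      (Measurable.ite (measurableSet_le hsb measurable_const) measurable_const measurable_const))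
  have hW0 : ∀ ω, 0 ≤ W ω := fun ω => by
    have := hs0 ω
    simp only [hW]
    split_ifs <;> simp [this, hb.le]
  have hWb : ∀ ω, W ω ≤ b := fun ω => by
    simp only [hW]
    split_ifs <;> simp
  have hWi : Integrable W P :=
    Integrable.of_bound hWm.aestronglyMeasurable b
      (ae_of_all _ fun ω => by rw [Real.norm_of_nonneg (hW0 ω)]; exact hWb ω)
  have hDi : Integrable D P := (hsi.sub (integrable_const b)).pos_part
  have hD0 : 0 ≤ ∫ ω, D ω ∂P := integral_nonneg fun ω => le_max_right _ _
  have welfare_eq : (∫ ω, (s ω + (b - s ω) * (if s ω ≤ p then (1:ℝ) else 0)) ∂P)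
      = (∫ ω, W ω ∂P) + ∫ ω, D ω ∂P := by
    rw [← integral_add hWi hDi]
    congr 1 with ω
    simp only [hW, hD]
    rcases le_or_gt (s ω) b with h | h
    · simp [min_eq_left h, max_eq_right (sub_nonpos.2 h)]
    · simp [min_eq_right h.le, max_eq_left (sub_pos.2 h).le, (hpb.trans_lt h).not_ge]
  have optimum_eq : (∫ ω, max (s ω) b ∂P) = b + ∫ ω, D ω ∂P := by
    have : (fun ω => max (s ω) b) = fun ω => b + D ω := by
      ext ω
      simp only [hD, ← max_add_add_left, add_sub_cancel, add_zero]
    rw [this, integral_add (integrable_const b) hDi]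
    simp
  have truncated_optimum_eq : (∫ ω, max (min (s ω) b) b ∂P) = b := by simp
  have hWle : ∫ ω, W ω ∂P ≤ b := by
    simpa using integral_mono hWi (integrable_const b) hWb
  rw [welfare_eq, optimum_eq, truncated_optimum_eq, ge_iff_le,
    div_le_div_iff₀ hb (by linarith)]
  nlinarith [mul_nonneg hD0 (sub_nonneg.2 hWle)]
end

section
/- Let n ≥ 3, let v₁, …, vₙ be nonnegative integrable real-valued random variables (the agents' values), let r₁, …, rₙ ≥ 0 with Σᵢ rᵢ = 1 (the initial shares), and let α ∈ (0, 1]. Suppose for each i there is a price pᵢ ∈ ℝ such that E[(if vᵢ ≤ pᵢ ∧ pᵢ ≤ max_{k ≠ i} v_k then max_{k ≠ i} v_k else vᵢ)] ≥ α · E[max_k v_k]. For each i define the welfare Wᵢ = (if vᵢ ≤ pᵢ* ∧ pᵢ* ≤ m₁ᵢ then m₁ᵢ else vᵢ), where m₁ᵢ = max_{k ≠ i} v_k, m₂ᵢ is the second-highest value among the agents other than i, and pᵢ* = max(pᵢ, m₂ᵢ). Then E[Σᵢ rᵢ · Wᵢ] ≥ α · E[max_k v_k]. -/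
open MeasureTheory ProbabilityTheory

/-- The highest value among the agents other than `i`. -/
noncomputable def highestOther {n : ℕ} (v : Fin n → ℝ) (i : Fin n) : ℝ :=
  ⨆ k : {k : Fin n // k ≠ i}, v k

/-- The second-highest value among the agents other than `i`
(characterized as `min_{j ≠ i} max_{k ∉ {i,j}} v k`). -/
noncomputable def secondHighestOther {n : ℕ} (v : Fin n → ℝ) (i : Fin n) : ℝ :=
  ⨅ j : {j : Fin n // j ≠ i}, ⨆ k : {k : Fin n // k ≠ i ∧ k ≠ (j : Fin n)}, v k

/-- The realized welfare when agent `i`'s item is offered at price `price` to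
a buyer of value `max_{k ≠ i} v k`: trade occurs iff `v i ≤ price ≤ max_{k≠i} v k`. -/
noncomputable def tradeWelfare {n : ℕ} (v : Fin n → ℝ) (i : Fin n) (price : ℝ) : ℝ :=
  if v i ≤ price ∧ price ≤ highestOther v i then highestOther v i else v i

theorem secondHighestOther_le_highestOther {n : ℕ} (hn : 3 ≤ n) (v : Fin n → ℝ) (i : Fin n) :
    secondHighestOther v i ≤ highestOther v i := by
  have : Nontrivial (Fin n) := Fin.nontrivial_iff_two_le.2 (by omega)
  obtain ⟨j, hj⟩ := exists_ne i
  obtain ⟨k, hki, hkj⟩ : ∃ k : Fin n, k ≠ i ∧ k ≠ j := by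
    obtain ⟨k, hk⟩ := Finset.exists_mem_notMem_of_card_lt_card
      (s := {i, j}) (t := (Finset.univ : Finset (Fin n)))
      (Finset.card_le_two.trans_lt (by rw [Finset.card_univ, Fintype.card_fin]; omega))
    exact ⟨k, by simpa using hk⟩
  have : Nonempty {k : Fin n // k ≠ i ∧ k ≠ j} := ⟨⟨k, hki, hkj⟩⟩
  exact (ciInf_le (Set.finite_range _).bddBelow (⟨j, hj⟩ : {j : Fin n // j ≠ i})).trans
    (ciSup_le fun l => le_ciSup (f := fun k : {k : Fin n // k ≠ i} => v k)
      (Set.finite_range _).bddAbove ⟨l, l.2.1⟩)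

/-- Raising the price to a floor that does not exceed the buyer's value never hurts welfare. -/
theorem tradeWelfare_le_tradeWelfare_max {n : ℕ} (v : Fin n → ℝ) (i : Fin n) (p : ℝ) {q : ℝ}
    (hq : q ≤ highestOther v i) : tradeWelfare v i p ≤ tradeWelfare v i (max p q) := by
  unfold tradeWelfare
  split_ifs with h h' h'
  · exact le_rfl
  · exact absurd ⟨h.1.trans (le_max_left _ _), max_le h.2 hq⟩ h'
  · exact h'.1.trans h'.2
  · exact le_rfl

theorem measurable_highestOther {n : ℕ} (i : Fin n) :
    Measurable fun v : Fin n → ℝ => highestOther v i :=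
  .iSup fun k => measurable_pi_apply k.1

theorem measurable_secondHighestOther {n : ℕ} (i : Fin n) :
    Measurable fun v : Fin n → ℝ => secondHighestOther v i :=
  .iInf fun _ => .iSup fun k => measurable_pi_apply k.1

theorem Measurable.tradeWelfare {n : ℕ} (i : Fin n) {price : (Fin n → ℝ) → ℝ}
    (hprice : Measurable price) :
    Measurable fun v : Fin n → ℝ => tradeWelfare v i (price v) :=
  .ite ((measurableSet_le (measurable_pi_apply i) hprice).inter
    (measurableSet_le hprice (measurable_highestOther i)))
    (measurable_highestOther i) (measurable_pi_apply i)

theorem abs_tradeWelfare_le_sum {n : ℕ} {v : Fin n → ℝ} (hv : ∀ k, 0 ≤ v k) (i : Fin n)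
    (price : ℝ) : |tradeWelfare v i price| ≤ ∑ k, v k := by
  have hle : ∀ k, v k ≤ ∑ k, v k := fun k =>
    Finset.single_le_sum (fun l _ => hv l) (Finset.mem_univ k)
  unfold tradeWelfare
  split_ifs
  · rw [highestOther, abs_of_nonneg (Real.iSup_nonneg fun k : {k // k ≠ i} => hv k)]
    exact Real.iSup_le (fun k => hle k) (Finset.sum_nonneg fun k _ => hv k)
  · rw [abs_of_nonneg (hv i)]
    exact hle i

theorem integrable_tradeWelfare {n : ℕ} {Ω : Type*} [MeasurableSpace Ω] {P : Measure Ω}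
    {v : Fin n → Ω → ℝ} (hvm : ∀ k, Measurable (v k)) (hv0 : ∀ k ω, 0 ≤ v k ω)
    (hvi : ∀ k, Integrable (v k) P) (i : Fin n) {price : (Fin n → ℝ) → ℝ}
    (hprice : Measurable price) :
    Integrable (fun ω => tradeWelfare (fun k => v k ω) i (price fun k => v k ω)) P :=
  (integrable_finsetSum Finset.univ fun k _ => hvi k).mono'
    ((Measurable.tradeWelfare i hprice).comp (measurable_pi_lambda _ hvm)).aestronglyMeasurable
    (.of_forall fun ω => abs_tradeWelfare_le_sum (fun k => hv0 k ω) i _)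

/-- **Partnership dissolving via per-agent second-price auctions with reserves.**
If for each agent `i` some price `pᵢ` gives an `α`-approximation for the
bilateral trade between seller `i` and a buyer of value `max_{k≠i} v k`, then
selling each agent's share `rᵢ` via a second-price auction with reserve `pᵢ`
gives expected welfare at least `α · E[max_k v k]`. -/
theorem partnership_dissolving_alpha_approx
    (n : ℕ) (hn : 3 ≤ n)
    {Ω : Type*} [MeasurableSpace Ω] {P : Measure Ω} [IsProbabilityMeasure P]
    (v : Fin n → Ω → ℝ) (hvm : ∀ k, Measurable (v k))
    (hv0 : ∀ k ω, 0 ≤ v k ω) (hvi : ∀ k, Integrable (v k) P)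
    (r : Fin n → ℝ) (hr0 : ∀ k, 0 ≤ r k) (hr1 : ∑ k, r k = 1)
    (α : ℝ) (hα0 : 0 < α) (hα1 : α ≤ 1)
    (p : Fin n → ℝ)
    (hp : ∀ i : Fin n,
      ∫ ω, tradeWelfare (fun k => v k ω) i (p i) ∂P
        ≥ α * ∫ ω, ⨆ k, v k ω ∂P) :
    ∫ ω, ∑ i, r i * tradeWelfare (fun k => v k ω) i
          (max (p i) (secondHighestOther (fun k => v k ω) i)) ∂P
      ≥ α * ∫ ω, ⨆ k, v k ω ∂P := by
  have hint : ∀ i, Integrable (fun ω => tradeWelfare (fun k => v k ω) i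
      (max (p i) (secondHighestOther (fun k => v k ω) i))) P := fun i =>
    integrable_tradeWelfare hvm hv0 hvi i
      (price := fun w => max (p i) (secondHighestOther w i))
      (measurable_const.max (measurable_secondHighestOther i))
  rw [integral_finsetSum _ fun i _ => (hint i).const_mul (r i), ge_iff_le]
  calc α * ∫ ω, ⨆ k, v k ω ∂P
      = ∑ i, r i * (α * ∫ ω, ⨆ k, v k ω ∂P) := by rw [← Finset.sum_mul, hr1, one_mul]
    _ ≤ _ := Finset.sum_le_sum fun i _ => by
      rw [integral_const_mul]
      refine mul_le_mul_of_nonneg_left ((hp i).trans (integral_mono ?_ (hint i) fun ω => ?_))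
        (hr0 i)
      · exact integrable_tradeWelfare hvm hv0 hvi i (price := fun _ => p i) measurable_const
      · exact tradeWelfare_le_tradeWelfare_max _ i (p i)
          (secondHighestOther_le_highestOther hn _ i)
end
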